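/- For every n ≥ 1, writing S_1 = Σ_{V(T)=n} J(T) and S_2 = Σ_{V(T)=n} J(T)², one has (8n − 4)·(b_n·S_2 − S_1²) = (n² − 1)·b_n²; equivalently, the variance of the number-of-jumps statistic J over the uniform distribution on full binary trees with n internal vertices equals (n² − 1)/(8n − 4). -/

import Mathlib

inductive BTree : Type
  | leaf : BTree
  | node : BTree → BTree → BTree

namespace BTree

/-- number of internal vertices -/
def V : BTree → ℕ
  | leaf => 0
  | node l r => V l + V r + 1

/-- depth of the rightmost leaf -/
def D : BTree → ℕ
  | leaf => 0
  | node _ r => 1 + D r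

/-- number of jumps -/
def J : BTree → ℕ
  | leaf => 0
  | node leaf r => J r
  | node (node l₁ r₁) r => J (node l₁ r₁) + J r + 1

/-- sum of jump distances -/
def JD : BTree → ℕ
  | leaf => 0
  | node l r => JD l + JD r + D l

end BTree

open PowerSeries in
/-- The Euler operator `x d/dx` on power series. -/
noncomputable def eulerOp (f : PowerSeries ℚ) : PowerSeries ℚ := X * derivative ℚ f

namespace BTree

theorem finite_V_le (n : ℕ) : {T : BTree | T.V ≤ n}.Finite := by
  induction n with
  | zero =>
    refine (Set.finite_singleton leaf).subset ?_
    intro T hT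
    cases T with
    | leaf => simp
    | node l r => simp [V] at hT
  | succ n ih =>
    refine ((Set.finite_singleton leaf).union (Set.Finite.image2 node ih ih)).subset ?_
    intro T hT
    cases T with
    | leaf => simp
    | node l r =>
      right
      simp only [Set.mem_ofPred_eq, V] at hT
      exact ⟨l, by simp only [Set.mem_ofPred_eq]; omega, r, by simp only [Set.mem_ofPred_eq]; omega, rfl⟩

theorem finite_V (n : ℕ) : {T : BTree | T.V = n}.Finite :=
  (finite_V_le n).subset fun _ hT => le_of_eq hT

/-- The finset of trees with `n` internal vertices. -/
noncomputable def trees (n : ℕ) : Finset BTree := (finite_V n).toFinset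

theorem mem_trees {n : ℕ} {T : BTree} : T ∈ trees n ↔ T.V = n := by simp [trees]

theorem trees_zero : trees 0 = {leaf} := by
  ext T
  rw [mem_trees]
  cases T <;> simp [V]

theorem sum_trees_succ (n : ℕ) (w : BTree → ℚ) :
    ∑ T ∈ trees (n + 1), w T =
      ∑ p ∈ Finset.HasAntidiagonal.antidiagonal n, ∑ l ∈ trees p.1, ∑ r ∈ trees p.2, w (node l r) := by
  simp_rw [← Finset.sum_product']
  rw [Finset.sum_sigma']
  symm
  refine Finset.sum_bij (fun x _ => node x.2.1 x.2.2) ?_ ?_ ?_ ?_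
  · rintro ⟨⟨i, j⟩, l, r⟩ h
    simp only [Finset.mem_sigma, Finset.HasAntidiagonal.mem_antidiagonal, Finset.mem_product, mem_trees] at h
    rw [mem_trees]
    simp only [V]
    omega
  · rintro ⟨⟨i, j⟩, l, r⟩ h ⟨⟨i', j'⟩, l', r'⟩ h' e
    simp only [Finset.mem_sigma, Finset.HasAntidiagonal.mem_antidiagonal, Finset.mem_product, mem_trees] at h h'
    simp only [node.injEq] at e
    obtain ⟨rfl, rfl⟩ := e
    obtain ⟨-, rfl, rfl⟩ := h
    obtain ⟨-, rfl, rfl⟩ := h'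
    rfl
  · intro T hT
    rw [mem_trees] at hT
    cases T with
    | leaf => simp [V] at hT
    | node l r =>
      simp only [V] at hT
      refine ⟨⟨(l.V, r.V), l, r⟩, ?_, rfl⟩
      simp only [Finset.mem_sigma, Finset.HasAntidiagonal.mem_antidiagonal, Finset.mem_product, mem_trees]
      exact ⟨by omega, trivial, trivial⟩
  · intros
    rfl

theorem J_node (l r : BTree) :
    ((node l r).J : ℚ) = l.J + r.J + (if l.V = 0 then 0 else 1) := by
  cases l <;> simp [J, V]

/-- number of trees -/
noncomputable def cc (n : ℕ) : ℚ := ∑ _T ∈ trees n, 1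
/-- first factorial moment -/
noncomputable def aa (n : ℕ) : ℚ := ∑ T ∈ trees n, (T.J : ℚ)
/-- second factorial moment -/
noncomputable def qq (n : ℕ) : ℚ := ∑ T ∈ trees n, (T.J : ℚ) * (T.J - 1)
/-- number of trees, without the leaf -/
noncomputable def dd (n : ℕ) : ℚ := if n = 0 then 0 else cc n

theorem cc_zero : cc 0 = 1 := by simp [cc, trees_zero]
theorem aa_zero : aa 0 = 0 := by simp [aa, trees_zero, J]
theorem qq_zero : qq 0 = 0 := by simp [qq, trees_zero, J]

theorem prod_sum (i j : ℕ) (f g : BTree → ℚ) :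
    ∑ l ∈ trees i, ∑ r ∈ trees j, f l * g r = (∑ l ∈ trees i, f l) * ∑ r ∈ trees j, g r := by
  rw [Finset.sum_mul_sum]

theorem cc_succ (n : ℕ) : cc (n + 1) = ∑ p ∈ Finset.HasAntidiagonal.antidiagonal n, cc p.1 * cc p.2 := by
  rw [cc, sum_trees_succ]
  refine Finset.sum_congr rfl fun p _ => ?_
  rw [cc, cc, ← prod_sum]
  simp

theorem aa_succ (n : ℕ) : aa (n + 1) = ∑ p ∈ Finset.HasAntidiagonal.antidiagonal n,
    (aa p.1 * cc p.2 + cc p.1 * aa p.2 + dd p.1 * cc p.2) := by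
  rw [aa, sum_trees_succ]
  refine Finset.sum_congr rfl fun p _ => ?_
  have hd : dd p.1 = ∑ l ∈ trees p.1, (if l.V = 0 then 0 else 1) := by
    rw [dd, cc]
    split_ifs with h
    · rw [h, trees_zero]; simp [V]
    · refine Finset.sum_congr rfl fun l hl => ?_
      rw [mem_trees] at hl
      rw [hl, if_neg h]
  rw [hd, aa, cc, cc, aa, ← prod_sum, ← prod_sum, ← prod_sum, ← Finset.sum_add_distrib,
    ← Finset.sum_add_distrib]
  refine Finset.sum_congr rfl fun l _ => ?_
  rw [← Finset.sum_add_distrib, ← Finset.sum_add_distrib]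
  refine Finset.sum_congr rfl fun r _ => ?_
  rw [J_node]
  ring

theorem qq_succ (n : ℕ) : qq (n + 1) = ∑ p ∈ Finset.HasAntidiagonal.antidiagonal n,
    (qq p.1 * cc p.2 + cc p.1 * qq p.2 + 2 * (aa p.1 * aa p.2) + 2 * (aa p.1 * cc p.2)
      + 2 * (dd p.1 * aa p.2)) := by
  rw [qq, sum_trees_succ]
  refine Finset.sum_congr rfl fun p _ => ?_
  have hd : dd p.1 = ∑ l ∈ trees p.1, (if l.V = 0 then 0 else 1) := by
    rw [dd, cc]
    split_ifs with h
    · rw [h, trees_zero]; simp [V]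
    · refine Finset.sum_congr rfl fun l hl => ?_
      rw [mem_trees] at hl
      rw [hl, if_neg h]
  rw [hd, qq, aa, cc, cc, aa, qq]
  simp only [← prod_sum]
  simp only [Finset.mul_sum]
  simp only [← Finset.sum_add_distrib]
  refine Finset.sum_congr rfl fun l _ => ?_
  refine Finset.sum_congr rfl fun r _ => ?_
  rw [J_node]
  cases l with
  | leaf => simp [V, J]
  | node l₁ l₂ => simp [V]; ring

end BTree

section Series
open PowerSeries

theorem eulerOp_add (f g : PowerSeries ℚ) : eulerOp (f + g) = eulerOp f + eulerOp g := by
  simp [eulerOp, mul_add]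

theorem eulerOp_sub (f g : PowerSeries ℚ) : eulerOp (f - g) = eulerOp f - eulerOp g := by
  simp [eulerOp, mul_sub]

theorem eulerOp_mul (f g : PowerSeries ℚ) :
    eulerOp (f * g) = f * eulerOp g + g * eulerOp f := by
  simp only [eulerOp, Derivation.leibniz, smul_eq_mul]
  ring

theorem eulerOp_zero : eulerOp 0 = 0 := by
  simp [eulerOp]

theorem eulerOp_one : eulerOp 1 = 0 := by
  simp [eulerOp]

theorem eulerOp_two : eulerOp 2 = 0 := by
  rw [← one_add_one_eq_two, eulerOp_add, eulerOp_one, add_zero]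

theorem eulerOp_X : eulerOp X = X := by
  simp [eulerOp]

theorem coeff_eulerOp (n : ℕ) (f : PowerSeries ℚ) : coeff n (eulerOp f) = n * coeff n f := by
  cases n with
  | zero => simp [eulerOp]
  | succ n =>
    rw [eulerOp, coeff_succ_X_mul, coeff_derivative]
    push_cast
    ring

theorem field_identity {K : Type*} [Field K] [CharZero K]
    (x B s L M T1 T2 T3 A A' Q Q' : K) (hs0 : s ≠ 0)
    (hs : s = 1 - 2 * x * B) (hB : B = 1 + x * (B * B)) (h1 : s * T1 = B - 1)
    (h2 : s * T2 + T1 * L = T1) (h3 : s * T3 + T2 * L + (T1 * M + L * T2) = T2)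
    (hL : s * L = - 2 * x) (hM : s * M + L * L = - 2 * x)
    (hA : s * A = x * (B * (B - 1)))
    (hQ : s * Q = 2 * x * (A * (2 * B - 1 + A)))
    (hA' : s * A' + A * L = x * (B * (B - 1)) + x * (T1 * (2 * B - 1)))
    (hQ' : s * Q' + Q * L = 2 * x * (A * (2 * B - 1 + A)) + 2 * x * (A' * (2 * B - 1 + A))
      + 2 * x * (A * (2 * T1 + A'))) :
    2 * A = T1 - B + 1 ∧
    4 * Q' - 2 * Q = T3 - 4 * T2 + 5 * T1 - 2 * B + 2 := by
  have hx : x = (1 - s ^ 2) / 4 := by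
    have : s ^ 2 = 1 - 4 * x := by rw [hs]; linear_combination -4 * x * hB
    rw [this]; ring
  have hBs : B * (1 + s) = 2 := by rw [hs]; linear_combination 2 * hB
  have hs1 : 1 + s ≠ 0 := by
    intro h; rw [h, mul_zero] at hBs; exact two_ne_zero hBs.symm
  have eB : B = 2 / (1 + s) := by rw [eq_div_iff hs1, hBs]
  clear hs hB hBs
  have e1 : T1 = (B - 1) / s := by rw [eq_div_iff hs0]; linear_combination h1
  have eL : L = -2 * x / s := by rw [eq_div_iff hs0]; linear_combination hL
  have eM : M = (-2 * x - L * L) / s := by rw [eq_div_iff hs0]; linear_combination hM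
  have e2 : T2 = (T1 - T1 * L) / s := by rw [eq_div_iff hs0]; linear_combination h2
  have e3 : T3 = (T2 - 2 * T2 * L - T1 * M) / s := by rw [eq_div_iff hs0]; linear_combination h3
  have eA : A = (x * (B * (B - 1))) / s := by rw [eq_div_iff hs0]; linear_combination hA
  have eQ : Q = (2 * x * (A * (2 * B - 1 + A))) / s := by
    rw [eq_div_iff hs0]; linear_combination hQ
  have eA' : A' = (x * (B * (B - 1)) + x * (T1 * (2 * B - 1)) - A * L) / s := by
    rw [eq_div_iff hs0]; linear_combination hA'
  have eQ' : Q' = (2 * x * (A * (2 * B - 1 + A)) + 2 * x * (A' * (2 * B - 1 + A))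
      + 2 * x * (A * (2 * T1 + A')) - Q * L) / s := by
    rw [eq_div_iff hs0]; linear_combination hQ'
  clear h1 h2 h3 hL hM hA hQ hA' hQ'
  have f1 : T1 = (1 - s) / (s * (1 + s)) := by rw [e1, eB]; field_simp; ring
  have fL : L = (s ^ 2 - 1) / (2 * s) := by rw [eL, hx]; field_simp; ring
  have fM : M = (s ^ 4 - 1) / (4 * s ^ 3) := by rw [eM, fL, hx]; field_simp; ring
  have fA : A = (1 - s) ^ 2 / (2 * s * (1 + s)) := by rw [eA, eB, hx]; field_simp; ring
  have fQ : Q = (1 - s) ^ 3 * (1 + 4 * s - s ^ 2) / (8 * s ^ 3 * (1 + s)) := by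
    rw [eQ, fA, eB, hx]; field_simp; ring
  subst hx eB
  refine ⟨?_, ?_⟩
  · rw [fA, f1]; field_simp; ring
  rw [eQ', eA', e3, e2, fQ, fA, fM, fL, f1]
  field_simp
  ring

open BTree

theorem series_identity :
    2 * mk aa = eulerOp (mk cc) - mk cc + 1 ∧
    4 * eulerOp (mk qq) - 2 * mk qq = eulerOp (eulerOp (eulerOp (mk cc)))
      - 4 * eulerOp (eulerOp (mk cc)) + 5 * eulerOp (mk cc) - 2 * mk cc + 2 := by
  have hd : mk dd = mk cc - 1 := by
    ext n
    cases n with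
    | zero => simp [dd, cc_zero]
    | succ n => simp [dd, coeff_one]
  have hB : mk cc = 1 + X * (mk cc * mk cc) := by
    ext n
    cases n with
    | zero => simp [cc_zero]
    | succ n => rw [map_add, coeff_succ_X_mul]; simp [coeff_one, coeff_mul, cc_succ]
  have hA0 : mk aa = X * (mk aa * mk cc + mk cc * mk aa + mk dd * mk cc) := by
    ext n
    cases n with
    | zero => simp [aa_zero]
    | succ n => rw [coeff_succ_X_mul]; simp [coeff_mul, aa_succ, Finset.sum_add_distrib]
  have hQ0 : mk qq = X * (mk qq * mk cc + mk cc * mk qq + C (2 : ℚ) * (mk aa * mk aa)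
      + C (2 : ℚ) * (mk aa * mk cc) + C (2 : ℚ) * (mk dd * mk aa)) := by
    ext n
    cases n with
    | zero => simp [qq_zero]
    | succ n =>
      rw [coeff_succ_X_mul]
      simp only [map_add, coeff_C_mul]
      simp only [coeff_mul, coeff_mk, qq_succ,
        Finset.sum_add_distrib, Finset.mul_sum]
  have hC : C (2 : ℚ) = (2 : PowerSeries ℚ) := map_ofNat C 2
  rw [hd] at hA0 hQ0
  rw [hC] at hQ0
  generalize mk cc = B at *
  generalize mk aa = A at *
  generalize mk qq = Q at *
  clear hd hC
  obtain ⟨s, hs⟩ : ∃ s, s = 1 - 2 * X * B := ⟨_, rfl⟩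
  have hs0 : s ≠ 0 := by
    intro h
    have := congrArg (coeff 0) (hs.symm.trans h)
    simp at this
  have hA : s * A = X * (B * (B - 1)) := by rw [hs]; linear_combination hA0
  have hQ : s * Q = 2 * X * (A * (2 * B - 1 + A)) := by rw [hs]; linear_combination hQ0
  have hss : s * s = 1 - 2 * (2 * X) := by rw [hs]; linear_combination -4 * X * hB
  have h1 : s * eulerOp B = B - 1 := by
    have := congrArg eulerOp hB
    simp only [eulerOp_add, eulerOp_mul, eulerOp_one, eulerOp_X] at this
    rw [hs]; linear_combination this - hB
  have h2 := congrArg eulerOp h1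
  have h3 := congrArg eulerOp h2
  have hL : s * eulerOp s = -2 * X := by
    have := congrArg eulerOp hss
    simp only [eulerOp_sub, eulerOp_mul, eulerOp_one, eulerOp_X, eulerOp_two] at this
    have h2' : (2 : PowerSeries ℚ) * (s * eulerOp s) = 2 * (-2 * X) := by
      linear_combination this
    have hcz : CharZero (PowerSeries ℚ) := algebraRat.charZero _
    have h20 : (2 : PowerSeries ℚ) ≠ 0 := two_ne_zero
    exact mul_left_cancel₀ h20 h2'
  have hM : s * eulerOp (eulerOp s) + eulerOp s * eulerOp s = -2 * X := by
    have h : s * eulerOp s = 0 - 2 * X := by rw [hL]; ring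
    have := congrArg eulerOp h
    simp only [eulerOp_sub, eulerOp_mul, eulerOp_X, eulerOp_two] at this
    have h0 : eulerOp 0 = 0 := by simp [eulerOp]
    rw [h0] at this
    linear_combination this
  have hA' := congrArg eulerOp hA
  have hQ' := congrArg eulerOp hQ
  simp only [eulerOp_sub, eulerOp_add, eulerOp_mul, eulerOp_one, eulerOp_X, eulerOp_two,
    eulerOp_zero] at h2 h3 hA' hQ'
  let φ := algebraMap (PowerSeries ℚ) (FractionRing (PowerSeries ℚ))
  have hφ : Function.Injective φ := IsFractionRing.injective _ _
  have : CharZero (FractionRing (PowerSeries ℚ)) := algebraRat.charZero _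
  have key := field_identity (φ X) (φ B) (φ s) (φ (eulerOp s)) (φ (eulerOp (eulerOp s)))
    (φ (eulerOp B)) (φ (eulerOp (eulerOp B))) (φ (eulerOp (eulerOp (eulerOp B))))
    (φ A) (φ (eulerOp A)) (φ Q) (φ (eulerOp Q))
    (by rwa [Ne, map_eq_zero_iff φ hφ])
    (by simpa [map_ofNat] using congrArg φ hs) (by simpa using congrArg φ hB) (by simpa using congrArg φ h1)
    (by have := congrArg φ h2; simp only [map_add, map_mul, map_sub, map_zero] at this
        linear_combination this)
    (by have := congrArg φ h3; simp only [map_add, map_mul, map_sub, map_zero] at this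
        linear_combination this)
    (by simpa [map_ofNat] using congrArg φ hL) (by simpa [map_ofNat] using congrArg φ hM)
    (by simpa using congrArg φ hA) (by simpa [map_ofNat] using congrArg φ hQ)
    (by have := congrArg φ hA'
        simp only [map_add, map_mul, map_sub, map_zero, map_one] at this
        linear_combination this)
    (by have := congrArg φ hQ'
        simp only [map_add, map_mul, map_sub, map_zero, map_one, map_ofNat] at this
        linear_combination this)
  constructor
  · apply hφ
    simpa [map_ofNat] using key.1
  · apply hφ
    simpa [map_ofNat] using key.2

theorem coeff_identities (n : ℕ) (hn : 1 ≤ n) :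
    2 * aa n = (n - 1) * cc n ∧ (4 * n - 2) * qq n = (n - 1) ^ 2 * (n - 2) * cc n := by
  obtain ⟨h1, h2⟩ := series_identity
  have c2 : (2 : PowerSeries ℚ) = C (2 : ℚ) := (map_ofNat C 2).symm
  have c4 : (4 : PowerSeries ℚ) = C (4 : ℚ) := (map_ofNat C 4).symm
  have c5 : (5 : PowerSeries ℚ) = C (5 : ℚ) := (map_ofNat C 5).symm
  rw [c2] at h1 h2
  rw [c4, c5] at h2
  have hn0 : n ≠ 0 := by omega
  have g1 := congrArg (coeff n) h1
  have g2 := congrArg (coeff n) h2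
  simp only [map_add, map_sub, coeff_C_mul, coeff_eulerOp, coeff_mk, coeff_one, coeff_C, hn0,
    if_false] at g1 g2
  exact ⟨by linear_combination g1, by linear_combination g2⟩

end Series

/-- The variance of the number-of-jumps statistic over the uniform
distribution on full binary trees with n ≥ 1 internal vertices is
(n² − 1)/(8n − 4): with S₁ = Σ J(T), S₂ = Σ J(T)², one has
(8n − 4)·(bₙ·S₂ − S₁²) = (n² − 1)·bₙ². -/
theorem stmt_10 (n : ℕ) (hn : 1 ≤ n)
    (b : ℚ) (hb : b = (Nat.card {T : BTree // T.V = n} : ℚ))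
    (S₁ : ℚ) (hS₁ : S₁ = ∑ᶠ T ∈ {T : BTree | T.V = n}, (T.J : ℚ))
    (S₂ : ℚ) (hS₂ : S₂ = ∑ᶠ T ∈ {T : BTree | T.V = n}, (T.J : ℚ) ^ 2) :
    (8 * n - 4 : ℚ) * (b * S₂ - S₁ ^ 2) = ((n : ℚ) ^ 2 - 1) * b ^ 2 := by
  
  obtain ⟨h1, h2⟩ := coeff_identities n hn
  have eb : b = BTree.cc n := by
    rw [hb, BTree.cc, Finset.sum_const, nsmul_eq_mul, mul_one]
    congr 1
    rw [BTree.trees, ← Set.ncard_eq_toFinset_card _ (BTree.finite_V n)]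
    rfl
  have e1 : S₁ = BTree.aa n := by
    rw [hS₁, finsum_mem_eq_finite_toFinset_sum _ (BTree.finite_V n)]
    rfl
  have e2 : S₂ = BTree.qq n + BTree.aa n := by
    rw [hS₂, finsum_mem_eq_finite_toFinset_sum _ (BTree.finite_V n), BTree.qq, BTree.aa,
      ← Finset.sum_add_distrib]
    refine Finset.sum_congr rfl fun T _ => ?_
    ring
  have h1' : BTree.aa n = (n - 1) * BTree.cc n / 2 := by linarith
  rw [eb, e2, e1, h1']
  linear_combination 2 * BTree.cc n * h2
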